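/- arXiv:math/9409215 — 2 statements merged into one kernel-verified Lean document; each statement's English description precedes it below -/
import Mathlib

section
/- Let F be a finite union-closed family of finite sets with ∅ ∈ F, let U ∈ J(F), and assume F = 𝒩³_F(U). Then the following are equivalent: (i) there exists an extension F' of (F, U) with μ_{F,F'}(U) < 2; (ii) there exists a filter H of 2^{N²∖U} such that μ_{F,F∨H}(U) < 2 and every minimal member X of H (i.e. no proper subset of X lies in H) satisfies |E_{F,U}(X)| = 1. -/
open Finset

/-- `F` is union-closed. -/
def UnionClosed {α : Type*} [DecidableEq α] (F : Finset (Finset α)) : Prop :=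
  ∀ A ∈ F, ∀ B ∈ F, A ∪ B ∈ F

/-- The generators `J(F)`: nonempty members of `F` that are not the union of the
members of `F` properly contained in them. -/
def gens {α : Type*} [DecidableEq α] (F : Finset (Finset α)) : Finset (Finset α) :=
  F.filter (fun U => U.Nonempty ∧ (F.filter (fun A => A ⊂ U)).sup id ≠ U)

/-- The closure `π_F(X)`: the union of all members of `F` contained in `X`. -/
def piF {α : Type*} [DecidableEq α] (F : Finset (Finset α)) (X : Finset α) : Finset α :=
  (F.filter (fun A => A ⊆ X)).sup id

/-- `F ∨ H = {A ∪ B : A ∈ F, B ∈ H}`. -/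
def famJoin {α : Type*} [DecidableEq α] (F H : Finset (Finset α)) : Finset (Finset α) :=
  (F ×ˢ H).image (fun p => p.1 ∪ p.2)

/-- `F'` is an extension of `(F, U)`: `F' = F ∨ H` for some nonempty union-closed
family `H` with `(⋃ H) ∩ U = ∅`. -/
def IsExtension {α : Type*} [DecidableEq α] (F : Finset (Finset α)) (U : Finset α)
    (F' : Finset (Finset α)) : Prop :=
  ∃ H : Finset (Finset α), H.Nonempty ∧ UnionClosed H ∧ (H.sup id) ∩ U = ∅ ∧ F' = famJoin F H

/-- The restriction of `F` away from `U`: `F_{∖U} = {A ∖ U : A ∈ F}`. -/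
def resAway {α : Type*} [DecidableEq α] (F : Finset (Finset α)) (U : Finset α) :
    Finset (Finset α) :=
  F.image (fun A => A \ U)

/-- `E_{F,U}(X)`: the subsets `Y ⊆ U` with `π_F(X ∪ Y) ∩ U = Y` and
`π_F(X ∪ Y) ⊇ π_F(X ∪ U) \ U`. -/
def Efam {α : Type*} [DecidableEq α] (F : Finset (Finset α)) (U X : Finset α) :
    Finset (Finset α) :=
  U.powerset.filter (fun Y => piF F (X ∪ Y) ∩ U = Y ∧ piF F (X ∪ U) \ U ⊆ piF F (X ∪ Y))

/-- `μ_{F,F'}(U) = (Σ_{X ∈ F'_{∖U}} |E_{F,U}(X)|) / |F'_{∖U}|`. -/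
def mu {α : Type*} [DecidableEq α] (F : Finset (Finset α)) (U : Finset α)
    (F' : Finset (Finset α)) : ℚ :=
  (∑ X ∈ resAway F' U, ((Efam F U X).card : ℚ)) / ((resAway F' U).card : ℚ)

/-- The union-closed family generated by `G` (all unions of subfamilies of `G`;
it contains `∅` as the empty union). -/
def genUC {α : Type*} [DecidableEq α] (G : Finset (Finset α)) : Finset (Finset α) :=
  G.powerset.image (fun S => S.sup id)

/-- The lattice neighborhood `𝒩_F(U)`: the union-closed family generated by `{∅}`
together with the generators of `F` meeting `U`. -/
def latNbhd {α : Type*} [DecidableEq α] (F : Finset (Finset α)) (U : Finset α) :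
    Finset (Finset α) :=
  genUC ((gens F).filter (fun V => (V ∩ U).Nonempty))

/-- The third lattice neighborhood `𝒩³_F(U) = 𝒩_F(⋃ 𝒩_F(U))`. -/
def latNbhd3 {α : Type*} [DecidableEq α] (F : Finset (Finset α)) (U : Finset α) :
    Finset (Finset α) :=
  latNbhd F ((latNbhd F U).sup id)

/-- The neighborhood `N_F(X) = X ∪ ⋃ {V ∈ J(F) : V ∩ X ≠ ∅}`. -/
def nbhd {α : Type*} [DecidableEq α] (F : Finset (Finset α)) (X : Finset α) : Finset α :=
  X ∪ ((gens F).filter (fun V => (V ∩ X).Nonempty)).sup id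

/-- `H` is a filter of `2^S`: a nonempty family of subsets of `S` closed upward in `S`. -/
def IsFilterOn {α : Type*} [DecidableEq α] (S : Finset α) (H : Finset (Finset α)) : Prop :=
  H.Nonempty ∧ (∀ X ∈ H, X ⊆ S) ∧ ∀ X ∈ H, ∀ Y, X ⊆ Y → Y ⊆ S → Y ∈ H

/-- `F'` minimizes `μ` in `D` (among extensions of `(F, U)` with union inside `D`). -/
def MinimizesMu {α : Type*} [DecidableEq α] (F : Finset (Finset α)) (U D : Finset α)
    (F' : Finset (Finset α)) : Prop :=
  F'.sup id ⊆ D ∧ ∀ F'', IsExtension F U F'' → F''.sup id ⊆ D → mu F U F' ≤ mu F U F''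

/-- The degree of `U` in the graph `G`: the number of members of `G` other than `U`
meeting `U`. -/
def degG {α : Type*} [DecidableEq α] (G : Finset (Finset α)) (U : Finset α) : ℕ :=
  (G.filter (fun V => V ≠ U ∧ (V ∩ U).Nonempty)).card

section
variable {α : Type*} [DecidableEq α] {F G H F' : Finset (Finset α)} {U S X X' : Finset α}

/-- The total excess over two of the cardinalities `|E_{F,U}(X)|` for `X ∈ G`. -/
def excess (F : Finset (Finset α)) (U : Finset α) (G : Finset (Finset α)) : ℤ :=
  ∑ X ∈ G, (((Efam F U X).card : ℤ) - 2)

/-- The up-compression of the family `G` along `z`. -/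
def upCompress (z : α) (G : Finset (Finset α)) : Finset (Finset α) :=
  G.image (fun X => if insert z X ∈ G then X else insert z X)

theorem mu_lt_two_iff (h : (resAway F' U).Nonempty) :
    mu F U F' < 2 ↔ excess F U (resAway F' U) < 0 := by
  have hpos : (0 : ℚ) < ((resAway F' U).card : ℚ) := by exact_mod_cast h.card_pos
  rw [mu, div_lt_iff₀ hpos, excess, sum_sub_distrib, sum_const, nsmul_eq_mul, sub_neg, mul_comm]
  exact_mod_cast Iff.rfl

theorem piF_congr (h : ∀ A ∈ F, A ⊆ X ↔ A ⊆ X') : piF F X = piF F X' := by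
  rw [piF, piF, filter_congr h]

theorem Efam_congr (h : ∀ A ∈ F, ∀ Y ⊆ U, A ⊆ X ∪ Y ↔ A ⊆ X' ∪ Y) :
    Efam F U X = Efam F U X' := by
  have hpi : ∀ Y ⊆ U, piF F (X ∪ Y) = piF F (X' ∪ Y) := fun Y hY =>
    piF_congr fun A hA => h A hA Y hY
  refine filter_congr fun Y hY => ?_
  rw [hpi Y (mem_powerset.1 hY), hpi U Subset.rfl]

theorem one_le_card_Efam (hU : U ∈ F) (X : Finset α) : 1 ≤ (Efam F U X).card := by
  refine card_pos.2 ⟨U, mem_filter.2 ⟨mem_powerset_self U, ?_, sdiff_subset⟩⟩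
  refine inter_eq_right.2 ?_
  exact le_sup (f := id) (mem_filter.2 ⟨hU, subset_union_right⟩)

theorem subset_nbhd_nbhd (hN3 : F = latNbhd3 F U) {A : Finset α} (hA : A ∈ F) :
    A ⊆ nbhd F (nbhd F U) := by
  have hsup : (latNbhd F U).sup id ⊆ nbhd F U := by
    refine Finset.sup_le fun B hB => ?_
    obtain ⟨T, hT, rfl⟩ := mem_image.1 hB
    exact (sup_mono (mem_powerset.1 hT)).trans subset_union_right
  rw [hN3] at hA
  obtain ⟨T, hT, rfl⟩ := mem_image.1 hA
  refine Finset.sup_le fun V hV => ?_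
  obtain ⟨hVF, hVne⟩ := mem_filter.1 (mem_powerset.1 hT hV)
  refine Subset.trans ?_ subset_union_right
  exact le_sup (f := id) (mem_filter.2 ⟨hVF, hVne.mono (inter_subset_inter_left hsup)⟩)

theorem mem_upCompress {z : α} :
    X ∈ upCompress z G ↔
      (X ∈ G ∧ insert z X ∈ G) ∨ (z ∈ X ∧ X ∉ G ∧ X.erase z ∈ G) := by
  simp only [upCompress, mem_image]
  constructor
  · rintro ⟨Y, hY, rfl⟩
    split_ifs with h
    · exact Or.inl ⟨hY, h⟩
    · have hz : z ∉ Y := fun hz => h (by rwa [insert_eq_of_mem hz])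
      exact Or.inr ⟨mem_insert_self _ _, h, by rwa [erase_insert hz]⟩
  · rintro (⟨h, h'⟩ | ⟨hz, h, h'⟩)
    · exact ⟨X, h, if_pos h'⟩
    · exact ⟨X.erase z, h', by rw [insert_erase hz, if_neg h]⟩

theorem insert_mem_upCompress {z : α} (h : X ∈ G) : insert z X ∈ upCompress z G := by
  by_cases h' : insert z X ∈ G
  · exact mem_upCompress.2 (Or.inl ⟨h', by rwa [insert_idem]⟩)
  · have hz : z ∉ X := fun hz => h' (by rwa [insert_eq_of_mem hz])
    exact mem_upCompress.2 (Or.inr ⟨mem_insert_self _ _, h', by rwa [erase_insert hz]⟩)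

theorem insert_mem_upCompress_of_mem {z : α} (h : X ∈ upCompress z G) :
    insert z X ∈ upCompress z G := by
  rcases mem_upCompress.1 h with ⟨h1, -⟩ | ⟨hz, -, -⟩
  · exact insert_mem_upCompress h1
  · rwa [insert_eq_of_mem hz]

theorem union_mem_upCompress {z : α} {t : Finset α} (hG : ∀ X ∈ G, X ∪ t ∈ G)
    (h : X ∈ upCompress z G) : X ∪ t ∈ upCompress z G := by
  rcases mem_upCompress.1 h with ⟨h1, h2⟩ | ⟨hz, -, h2⟩
  · exact mem_upCompress.2 (Or.inl ⟨hG _ h1, by rw [← insert_union]; exact hG _ h2⟩)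
  · have := insert_mem_upCompress (z := z) (hG _ h2)
    rwa [← insert_union, insert_erase hz] at this

theorem excess_upCompress {z : α} (hz : z ∉ U) (hG : ∀ A ∈ F, ∀ X ∈ G, X ∪ (A \ U) ∈ G) :
    excess F U (upCompress z G) = excess F U G := by
  unfold excess upCompress
  rw [sum_image]
  · refine sum_congr rfl fun X hX => ?_
    split_ifs with h
    · rfl
    · rw [Efam_congr (X := insert z X) (X' := X)]
      intro A hA Y hY
      refine ⟨fun hAX => ?_, fun hAX => hAX.trans (union_subset_union_left (subset_insert _ _))⟩
      by_contra hAX'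
      have hzA : z ∈ A := by
        by_contra hzA
        rw [insert_union] at hAX
        exact hAX' ((subset_insert_iff_of_notMem hzA).1 hAX)
      refine h ?_
      have : insert z X = X ∪ (A \ U) := by
        ext a
        have ha := @hAX a
        have ha' := @hY a
        simp only [mem_union, mem_insert, mem_sdiff] at ha ⊢
        constructor
        · rintro (rfl | h)
          · exact Or.inr ⟨hzA, hz⟩
          · exact Or.inl h
        · tauto
      rw [this]
      exact hG A hA X hX
  · intro X hX Y hY hXY
    have hX : X ∈ G := hX
    have hY : Y ∈ G := hY
    simp only at hXY
    split_ifs at hXY with h1 h2 h2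
    · exact hXY
    · exact absurd (hXY ▸ hX) h2
    · exact absurd (hXY ▸ hY) h1
    · have hzX : z ∉ X := fun hz => h1 (by rwa [insert_eq_of_mem hz])
      have hzY : z ∉ Y := fun hz => h2 (by rwa [insert_eq_of_mem hz])
      rw [← erase_insert hzX, hXY, erase_insert hzY]

theorem exists_insert_closed (hSU : Disjoint S U) (hGS : ∀ X ∈ G, X ⊆ S)
    (hG : ∀ A ∈ F, ∀ X ∈ G, X ∪ (A \ U) ∈ G) {D : Finset α} (hD : D ⊆ S) :
    ∃ H : Finset (Finset α), (∀ X ∈ H, X ⊆ S) ∧ (∀ A ∈ F, ∀ X ∈ H, X ∪ (A \ U) ∈ H) ∧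
      (∀ z ∈ D, ∀ X ∈ H, X ∪ {z} ∈ H) ∧ excess F U H = excess F U G := by
  induction D using Finset.induction_on with
  | empty => exact ⟨G, hGS, hG, by simp, rfl⟩
  | insert z D _ ih =>
    obtain ⟨H, hS, hF, hz, he⟩ := ih ((subset_insert _ _).trans hD)
    have hzS : z ∈ S := hD (mem_insert_self _ _)
    refine ⟨upCompress z H, fun X hX => ?_, fun A hA X hX => union_mem_upCompress (hF A hA) hX,
      fun w hw X hX => ?_, (excess_upCompress (disjoint_left.1 hSU hzS) hF).trans he⟩
    · rcases mem_upCompress.1 hX with ⟨h, -⟩ | ⟨-, -, h⟩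
      · exact hS X h
      · exact erase_subset_iff_of_mem hzS |>.1 (hS _ h)
    · rcases mem_insert.1 hw with rfl | hw
      · rw [union_comm, ← insert_eq]
        exact insert_mem_upCompress_of_mem hX
      · exact union_mem_upCompress (hz w hw) hX

theorem nonempty_of_excess_neg (h : excess F U G < 0) : G.Nonempty := by
  rw [nonempty_iff_ne_empty]
  rintro rfl
  simp [excess] at h

theorem exists_filter_excess_neg (hSU : Disjoint S U) (hGS : ∀ X ∈ G, X ⊆ S)
    (hG : ∀ A ∈ F, ∀ X ∈ G, X ∪ (A \ U) ∈ G) (hneg : excess F U G < 0) :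
    ∃ H : Finset (Finset α), IsFilterOn S H ∧ excess F U H < 0 := by
  obtain ⟨H, hS, -, hz, he⟩ := exists_insert_closed hSU hGS hG Subset.rfl
  rw [← he] at hneg
  refine ⟨H, ⟨nonempty_of_excess_neg hneg, hS, fun X hX Y hXY hY => ?_⟩, hneg⟩
  have key : ∀ D ⊆ S, X ∪ D ∈ H := by
    intro D
    induction D using Finset.induction_on with
    | empty => intro _; rwa [union_empty]
    | insert z D _ ih =>
      intro hD
      have := hz z (hD (mem_insert_self _ _)) _ (ih ((subset_insert _ _).trans hD))
      rwa [union_assoc, union_comm D, ← insert_eq] at this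
  rw [← union_eq_right.2 hXY]
  exact key Y hY

theorem exists_slice_excess_neg (hFS : ∀ A ∈ F, A \ U ⊆ S) (hGU : ∀ X ∈ G, Disjoint X U)
    (hG : ∀ A ∈ F, ∀ X ∈ G, X ∪ (A \ U) ∈ G) (hneg : excess F U G < 0) :
    ∃ H : Finset (Finset α), (∀ X ∈ H, X ⊆ S) ∧ (∀ A ∈ F, ∀ X ∈ H, X ∪ (A \ U) ∈ H) ∧
      excess F U H < 0 := by
  have hE : ∀ X ∈ G, Efam F U X = Efam F U (X ∩ S) := by
    intro X hX
    refine Efam_congr fun A hA Y hY =>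
      ⟨fun h a ha => ?_, fun h => h.trans (union_subset_union_left inter_subset_left)⟩
    rcases mem_union.1 (h ha) with haX | haY
    · exact mem_union_left _ (mem_inter.2 ⟨haX, hFS A hA
        (mem_sdiff.2 ⟨ha, disjoint_left.1 (hGU X hX) haX⟩)⟩)
    · exact mem_union_right _ haY
  rw [excess, ← sum_fiberwise_of_maps_to (t := G.image (· \ S))
    (fun X hX => mem_image_of_mem _ hX)] at hneg
  obtain ⟨Q, -, hQ⟩ := exists_lt_of_sum_lt (hneg.trans_eq sum_const_zero.symm)
  refine ⟨(G.filter (· \ S = Q)).image (· ∩ S), ?_, ?_, ?_⟩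
  · simp only [mem_image]
    rintro _ ⟨X, -, rfl⟩
    exact inter_subset_right
  · simp only [mem_image, mem_filter]
    rintro A hA _ ⟨X, ⟨hX, hXQ⟩, rfl⟩
    refine ⟨X ∪ (A \ U), ⟨hG A hA X hX, ?_⟩, ?_⟩
    · rw [union_sdiff_distrib, sdiff_eq_empty_iff_subset.2 (hFS A hA), union_empty, hXQ]
    · rw [union_inter_distrib_right, inter_eq_left.2 (hFS A hA)]
  · rw [excess, sum_image]
    · refine lt_of_eq_of_lt (sum_congr rfl fun X hX => ?_) hQ
      rw [hE X (mem_filter.1 hX).1]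
    · intro X hX Y hY hXY
      have hX := (mem_filter.1 hX).2
      have hY := (mem_filter.1 hY).2
      simp only at hXY
      rw [← sdiff_union_inter X S, ← sdiff_union_inter Y S, hX, hY, hXY]

theorem exists_minimal_filter (hU : U ∈ F) (hH : IsFilterOn S H) (hneg : excess F U H < 0) :
    ∃ H' : Finset (Finset α), IsFilterOn S H' ∧ excess F U H' < 0 ∧
      ∀ X ∈ H', (∀ Z, Z ⊂ X → Z ∉ H') → (Efam F U X).card = 1 := by
  induction hn : H.card using Nat.strong_induction_on generalizing H with
  | _ n ih =>
    by_contra! hcon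
    obtain ⟨X, hX, hmin, hne⟩ := hcon H hH hneg
    have h1 := one_le_card_Efam hU X
    have hE : excess F U (H.erase X) < 0 := by
      have := add_sum_erase H (fun X => ((Efam F U X).card : ℤ) - 2) hX
      unfold excess at hneg ⊢
      omega
    have hF : IsFilterOn S (H.erase X) := by
      refine ⟨nonempty_of_excess_neg hE, fun Y hY => hH.2.1 Y (mem_of_mem_erase hY),
        fun Y hY Z hYZ hZ => mem_erase.2 ⟨?_, hH.2.2 Y (mem_of_mem_erase hY) Z hYZ hZ⟩⟩
      rintro rfl
      exact hmin Y (hYZ.ssubset_of_ne (ne_of_mem_erase hY)) (mem_of_mem_erase hY)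
    obtain ⟨H', h1, h2, h3⟩ := ih _ (by rw [← hn]; exact card_erase_lt_of_mem hX) hF hE rfl
    obtain ⟨Y, hY, hY', hY''⟩ := hcon H' h1 h2
    exact hY'' (h3 Y hY hY')

theorem resAway_famJoin_filter (hempty : ∅ ∈ F) (hFS : ∀ A ∈ F, A \ U ⊆ S)
    (hSU : Disjoint S U) (hH : IsFilterOn S H) : resAway (famJoin F H) U = H := by
  ext X
  simp only [resAway, famJoin, mem_image, mem_product, Prod.exists]
  constructor
  · rintro ⟨_, ⟨A, B, ⟨hA, hB⟩, rfl⟩, rfl⟩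
    have hBU := hH.2.1 B hB
    rw [union_sdiff_distrib, sdiff_eq_self_of_disjoint (hSU.mono_left hBU)]
    exact hH.2.2 B hB _ subset_union_right (union_subset (hFS A hA) hBU)
  · intro hX
    exact ⟨X, ⟨∅, X, ⟨hempty, hX⟩, empty_union X⟩,
      sdiff_eq_self_of_disjoint (hSU.mono_left (hH.2.1 X hX))⟩

theorem union_sdiff_mem_resAway_famJoin (hUC : UnionClosed F) {A : Finset α} (hA : A ∈ F)
    (hX : X ∈ resAway (famJoin F H) U) : X ∪ (A \ U) ∈ resAway (famJoin F H) U := by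
  simp only [resAway, famJoin, mem_image, mem_product, Prod.exists] at hX ⊢
  obtain ⟨_, ⟨B, C, ⟨hB, hC⟩, rfl⟩, rfl⟩ := hX
  exact ⟨_, ⟨B ∪ A, C, ⟨hUC B hB A hA, hC⟩, rfl⟩, by
    rw [← union_sdiff_distrib, union_right_comm]⟩

theorem IsFilterOn.isExtension (hSU : Disjoint S U) (hH : IsFilterOn S H) :
    IsExtension F U (famJoin F H) := by
  refine ⟨H, hH.1, fun A hA B hB => hH.2.2 A hA _ subset_union_left
    (union_subset (hH.2.1 A hA) (hH.2.1 B hB)), ?_, rfl⟩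
  exact disjoint_iff_inter_eq_empty.1 (hSU.mono_left (Finset.sup_le hH.2.1))

end

/-- Theorem 3.19: with `U ∈ J(F)` and `F = 𝒩³_F(U)`, the following are
equivalent: (i) some extension `F'` of `(F, U)` has `μ_{F,F'}(U) < 2`;
(ii) some filter `H` of `2^{N²∖U}` has `μ_{F,F∨H}(U) < 2` and every minimal
member `X` of `H` satisfies `|E_{F,U}(X)| = 1`. -/
theorem stmt14 {α : Type*} [DecidableEq α] (F : Finset (Finset α))
    (hUC : UnionClosed F) (hempty : ∅ ∈ F) (U : Finset α) (hU : U ∈ gens F)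
    (hN3 : F = latNbhd3 F U) :
    (∃ F' : Finset (Finset α), IsExtension F U F' ∧ mu F U F' < 2) ↔
      (∃ H : Finset (Finset α),
        IsFilterOn (nbhd F (nbhd F U) \ U) H ∧
        mu F U (famJoin F H) < 2 ∧
        ∀ X ∈ H, (∀ Z, Z ⊂ X → Z ∉ H) → (Efam F U X).card = 1) := by
  set S := nbhd F (nbhd F U) \ U with hS
  have hSU : Disjoint S U := sdiff_disjoint
  have hUF : U ∈ F := (mem_filter.1 hU).1
  have hFS : ∀ A ∈ F, A \ U ⊆ S := fun A hA =>
    sdiff_subset_sdiff (subset_nbhd_nbhd hN3 hA) Subset.rfl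
  constructor
  · rintro ⟨F', ⟨H₀, ⟨B, hB⟩, -, -, rfl⟩, hmu⟩
    have hne : (resAway (famJoin F H₀) U).Nonempty :=
      ⟨(∅ ∪ B) \ U, mem_image_of_mem _ (mem_image.2 ⟨(∅, B), mem_product.2 ⟨hempty, hB⟩, rfl⟩)⟩
    have hdisj : ∀ X ∈ resAway (famJoin F H₀) U, Disjoint X U := fun X hX => by
      obtain ⟨A, -, rfl⟩ := mem_image.1 hX
      exact sdiff_disjoint
    obtain ⟨G, hGS, hG, hneg⟩ := exists_slice_excess_neg hFS hdisj
      (fun A hA X hX => union_sdiff_mem_resAway_famJoin hUC hA hX) ((mu_lt_two_iff hne).1 hmu)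
    obtain ⟨H₁, hH₁, hneg₁⟩ := exists_filter_excess_neg hSU hGS hG hneg
    obtain ⟨H, hH, hnegH, hmin⟩ := exists_minimal_filter hUF hH₁ hneg₁
    have hres := resAway_famJoin_filter hempty hFS hSU hH
    refine ⟨H, hH, ?_, hmin⟩
    rw [mu_lt_two_iff (by rw [hres]; exact hH.1), hres]
    exact hnegH
  · rintro ⟨H, hH, hmu, -⟩
    exact ⟨famJoin F H, hH.isExtension hSU, hmu⟩
end

section
/- Let F be a finite union-closed family of finite sets with ∅ ∈ F whose generators J(F) form a graph, let U = {a, b} ∈ J(F) with a ≠ b, and let H be a filter of 2^{N²∖U} such that every minimal member X of H satisfies |E_{F,U}(X)| = 1. Then every X ∈ H satisfies X ∩ N_a ≠ ∅ and X ∩ N_b ≠ ∅. -/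
open Finset

theorem mem_piF_iff {α : Type*} [DecidableEq α] {F : Finset (Finset α)} {X : Finset α} {x : α} :
    x ∈ piF F X ↔ ∃ A ∈ F, A ⊆ X ∧ x ∈ A := by
  simp [piF, Finset.mem_sup, and_assoc]

theorem piF_subset {α : Type*} [DecidableEq α] (F : Finset (Finset α)) (X : Finset α) :
    piF F X ⊆ X := by
  intro x hx
  obtain ⟨A, -, hAX, hxA⟩ := mem_piF_iff.1 hx
  exact hAX hxA

theorem mem_of_mem_gens {α : Type*} [DecidableEq α] {F : Finset (Finset α)} {V : Finset α}
    (hV : V ∈ gens F) : V ∈ F :=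
  (Finset.mem_filter.1 hV).1

theorem exists_gens_of_mem {α : Type*} [DecidableEq α] {F : Finset (Finset α)} {x : α}
    (A : Finset α) (hA : A ∈ F) (hx : x ∈ A) : ∃ V ∈ gens F, V ⊆ A ∧ x ∈ V := by
  induction A using Finset.strongInduction with
  | H A ih =>
    by_cases hg : A ∈ gens F
    · exact ⟨A, hg, Finset.Subset.refl A, hx⟩
    · have hsup : (F.filter (fun B => B ⊂ A)).sup id = A := by
        by_contra h
        exact hg (Finset.mem_filter.2 ⟨hA, ⟨x, hx⟩, h⟩)
      rw [← hsup, Finset.mem_sup] at hx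
      obtain ⟨B, hB, hxB⟩ := hx
      obtain ⟨hBF, hBA⟩ := Finset.mem_filter.1 hB
      obtain ⟨V, hV, hVB, hxV⟩ := ih B hBA hBF hxB
      exact ⟨V, hV, hVB.trans hBA.subset, hxV⟩

/-- In a graph, a vertex outside `U` that lies in the closure of `X ∪ U` but not in that of
`X ∪ Y` is joined to a vertex of `U \ Y`. -/
theorem exists_edge_of_notMem_piF {α : Type*} [DecidableEq α] {F : Finset (Finset α)}
    (hgraph : ∀ V ∈ gens F, V.card = 1 ∨ V.card = 2) {U X Y : Finset α} {x : α}
    (hx : x ∈ piF F (X ∪ U) \ U) (hxY : x ∉ piF F (X ∪ Y)) :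
    x ∈ X ∧ ∃ u ∈ U, u ∉ Y ∧ ({x, u} : Finset α) ∈ gens F := by
  obtain ⟨hx, hxU⟩ := Finset.mem_sdiff.1 hx
  have hxX : x ∈ X := (Finset.mem_union.1 (piF_subset _ _ hx)).resolve_right hxU
  refine ⟨hxX, ?_⟩
  obtain ⟨A, hA, hAX, hxA⟩ := mem_piF_iff.1 hx
  obtain ⟨V, hV, hVA, hxV⟩ := exists_gens_of_mem A hA hxA
  have hnot : ¬ V ⊆ X ∪ Y := fun h =>
    hxY (mem_piF_iff.2 ⟨V, mem_of_mem_gens hV, h, hxV⟩)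
  obtain ⟨u, huV, hu⟩ := Finset.not_subset.1 hnot
  rw [Finset.mem_union, not_or] at hu
  have huU : u ∈ U := (Finset.mem_union.1 (hAX (hVA huV))).resolve_left hu.1
  have hxu : x ≠ u := fun h => hu.1 (h ▸ hxX)
  have hsub : ({x, u} : Finset α) ⊆ V := by
    simp [Finset.insert_subset_iff, hxV, huV]
  have hcard : V.card ≤ ({x, u} : Finset α).card := by
    rw [Finset.card_pair hxu]
    rcases hgraph V hV with h | h <;> omega
  exact ⟨u, huU, hu.2, Finset.eq_of_subset_of_card_le hsub hcard ▸ hV⟩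

theorem exists_private_neighbor {α : Type*} [DecidableEq α] {F : Finset (Finset α)}
    (hgraph : ∀ V ∈ gens F, V.card = 1 ∨ V.card = 2) {a b : α} (hab : a ≠ b)
    (hU : ({a, b} : Finset α) ∈ gens F) {X : Finset α} (hX : Disjoint X {a, b})
    (hE : (Efam F {a, b} X).card = 1) :
    ∃ x ∈ X, ({x, a} : Finset α) ∉ gens F ∧ ({x, b} : Finset α) ∈ gens F := by
  have hUE : ({a, b} : Finset α) ∈ Efam F {a, b} X := by
    refine Finset.mem_filter.2 ⟨Finset.mem_powerset_self _, ?_, Finset.sdiff_subset⟩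
    refine Finset.inter_eq_right.2 fun y hy => mem_piF_iff.2 ?_
    exact ⟨_, mem_of_mem_gens hU, Finset.subset_union_right, hy⟩
  have huniq : ∀ Y ∈ Efam F {a, b} X, Y = {a, b} := fun Y hY =>
    Finset.card_le_one.1 hE.le Y hY _ hUE
  have haX : a ∉ X := fun h => Finset.disjoint_left.1 hX h (by simp)
  have hbX : b ∉ X := fun h => Finset.disjoint_left.1 hX h (by simp)
  by_cases hsub : piF F (X ∪ {a, b}) \ {a, b} ⊆ piF F (X ∪ {a})
  · have hnoedge : ∀ x ∈ X, ({x, a} : Finset α) ∉ gens F := by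
      intro x hx hxa
      have hbmem : b ∉ piF F (X ∪ {a}) := fun h => by
        simpa [hbX, hab.symm] using piF_subset _ _ h
      have hamem : a ∈ piF F (X ∪ {a}) :=
        mem_piF_iff.2 ⟨_, mem_of_mem_gens hxa, by simp [Finset.insert_subset_iff, hx], by simp⟩
      have heq := huniq {a} (Finset.mem_filter.2 ⟨by simp, by ext y; grind, hsub⟩)
      have hb : b ∈ ({a} : Finset α) := heq ▸ by simp
      exact hab (Finset.mem_singleton.1 hb).symm
    have hempty_notMem : ∅ ∉ Efam F {a, b} X := fun h => by
      exact (Finset.insert_ne_empty a {b}) (huniq ∅ h).symm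
    have hnot : ¬ piF F (X ∪ {a, b}) \ {a, b} ⊆ piF F (X ∪ ∅) := fun h => by
      refine hempty_notMem (Finset.mem_filter.2 ⟨by simp, ?_, h⟩)
      refine Finset.disjoint_iff_inter_eq_empty.1 (hX.mono_left ?_)
      simpa using piF_subset F X
    obtain ⟨x, hx, hx'⟩ := Finset.not_subset.1 hnot
    obtain ⟨hxX, u, hu, -, hxu⟩ := exists_edge_of_notMem_piF hgraph hx hx'
    refine ⟨x, hxX, hnoedge x hxX, ?_⟩
    rcases Finset.mem_insert.1 hu with rfl | hu
    · exact absurd hxu (hnoedge x hxX)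
    · rwa [Finset.mem_singleton.1 hu] at hxu
  · obtain ⟨x, hx, hx'⟩ := Finset.not_subset.1 hsub
    obtain ⟨hxX, u, hu, hua, hxu⟩ := exists_edge_of_notMem_piF hgraph hx hx'
    refine ⟨x, hxX, fun hxa => hx' ?_, ?_⟩
    · exact mem_piF_iff.2
        ⟨_, mem_of_mem_gens hxa, by simp [Finset.insert_subset_iff, hxX], by simp⟩
    · have hub : u = b := by simpa [Finset.mem_singleton.not.1 hua] using hu
      exact hub ▸ hxu

theorem mem_nbhd_of_edge {α : Type*} [DecidableEq α] {F : Finset (Finset α)} {U : Finset α}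
    {x u : α} (hu : u ∈ U) (hxu : ({x, u} : Finset α) ∈ gens F) : x ∈ nbhd F U := by
  refine Finset.mem_union_right _ (Finset.mem_sup.2 ⟨{x, u}, ?_, by simp⟩)
  exact Finset.mem_filter.2 ⟨hxu, u, by simp [hu]⟩

/-- Lemma 3.21: with `J(F)` a graph, `U = {a, b} ∈ J(F)` (`a ≠ b`), and `H` a
filter of `2^{N²∖U}` whose minimal members `X` satisfy `|E_{F,U}(X)| = 1`,
every `X ∈ H` meets both `N_a` and `N_b`. -/
theorem stmt15 {α : Type*} [DecidableEq α] (F : Finset (Finset α))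
    (hUC : UnionClosed F) (hempty : ∅ ∈ F)
    (hgraph : ∀ V ∈ gens F, V.card = 1 ∨ V.card = 2)
    (a b : α) (hab : a ≠ b) (hU : ({a, b} : Finset α) ∈ gens F)
    (H : Finset (Finset α))
    (hH : IsFilterOn (nbhd F (nbhd F {a, b}) \ {a, b}) H)
    (hmin : ∀ X ∈ H, (∀ Z, Z ⊂ X → Z ∉ H) → (Efam F {a, b} X).card = 1) :
    ∀ X ∈ H,
      (X ∩ ((nbhd F {a, b} \ {a, b}).filter
        (fun x => ({x, a} : Finset α) ∈ gens F ∧ ({x, b} : Finset α) ∉ gens F))).Nonempty ∧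
      (X ∩ ((nbhd F {a, b} \ {a, b}).filter
        (fun x => ({x, a} : Finset α) ∉ gens F ∧ ({x, b} : Finset α) ∈ gens F))).Nonempty := by
  intro X hX
  obtain ⟨Z, hZX, hZ⟩ := exists_minimal_le_of_wellFoundedLT (fun Z => Z ∈ H) X hX
  have hE := hmin Z hZ.prop fun W hW hWH => hW.not_subset (hZ.le_of_le hWH hW.subset)
  have hdisj : Disjoint Z {a, b} :=
    Finset.disjoint_of_subset_left (hH.2.1 Z hZ.prop) Finset.sdiff_disjoint
  have hnotMem : ∀ x ∈ Z, x ∉ ({a, b} : Finset α) := fun x hx => Finset.disjoint_left.1 hdisj hx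
  constructor
  · obtain ⟨x, hx, hxb, hxa⟩ := exists_private_neighbor hgraph hab.symm
      (Finset.pair_comm a b ▸ hU) (Finset.pair_comm a b ▸ hdisj) (Finset.pair_comm a b ▸ hE)
    exact ⟨x, Finset.mem_inter.2 ⟨hZX hx, Finset.mem_filter.2
      ⟨Finset.mem_sdiff.2 ⟨mem_nbhd_of_edge (by simp) hxa, hnotMem x hx⟩, hxa, hxb⟩⟩⟩
  · obtain ⟨x, hx, hxa, hxb⟩ := exists_private_neighbor hgraph hab hU hdisj hE
    exact ⟨x, Finset.mem_inter.2 ⟨hZX hx, Finset.mem_filter.2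
      ⟨Finset.mem_sdiff.2 ⟨mem_nbhd_of_edge (by simp) hxb, hnotMem x hx⟩, hxa, hxb⟩⟩⟩
end
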